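/- For every integer n ≥ 5, sbal(n, K_{1,3}) = n−1; that is, every 2-edge-colouring of K_n with min{|R|,|B|} ≥ n contains both a copy of K_{1,3} with exactly two red edges and one blue edge and a copy of K_{1,3} with exactly two blue edges and one red edge, and there is a 2-edge-colouring of K_n with min{|R|,|B|} = n−1 for which one of these two types of copy does not occur. -/

import Mathlib

/-- The set of red edges of a 2-edge-colouring of `K_n`
    (`true` = red, `false` = blue). -/
def redEdges (n : ℕ) (c : Sym2 (Fin n) → Bool) : Finset (Sym2 (Fin n)) :=
  (⊤ : SimpleGraph (Fin n)).edgeFinset.filter (fun e => c e = true)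

/-- The set of blue edges of a 2-edge-colouring of `K_n`. -/
def blueEdges (n : ℕ) (c : Sym2 (Fin n) → Bool) : Finset (Sym2 (Fin n)) :=
  (⊤ : SimpleGraph (Fin n)).edgeFinset.filter (fun e => c e = false)

/-- An `(r,b)`-coloured copy of the star `K_{1,3}` in a 2-edge-coloured `K_n`: four
distinct vertices, a centre `v` and leaves `a₁, a₂, a₃`, such that exactly `r` of the
three edges are red and exactly `b` are blue. -/
def StarCopy (n : ℕ) (c : Sym2 (Fin n) → Bool) (r b : ℕ) : Prop :=
  ∃ v a₁ a₂ a₃ : Fin n, ([v, a₁, a₂, a₃] : List (Fin n)).Nodup ∧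
    ((if c s(v, a₁) = true then 1 else 0) + (if c s(v, a₂) = true then 1 else 0) +
      (if c s(v, a₃) = true then 1 else 0) = r) ∧
    ((if c s(v, a₁) = false then 1 else 0) + (if c s(v, a₂) = false then 1 else 0) +
      (if c s(v, a₃) = false then 1 else 0) = b)

/-- If every vertex with two distinct neighbours is adjacent to all other vertices, then the
graph is complete or has fewer edges than vertices. -/
theorem SimpleGraph.eq_top_or_card_edgeFinset_lt {V : Type*} [Fintype V] [DecidableEq V]
    [Nonempty V] (G : SimpleGraph V) [DecidableRel G.Adj]
    (h : ∀ v a b d, a ≠ b → G.Adj v a → G.Adj v b → v ≠ d → G.Adj v d) :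
    G = ⊤ ∨ G.edgeFinset.card < Fintype.card V := by
  refine or_iff_not_imp_left.2 fun htop => ?_
  have huniv : ∀ v, 1 < G.degree v → ∀ d, v ≠ d → G.Adj v d := by
    intro v hv d hd
    obtain ⟨a, ha, b, hb, hab⟩ := Finset.one_lt_card.1 hv
    exact h v a b d hab ((G.mem_neighborFinset v a).1 ha) ((G.mem_neighborFinset v b).1 hb) hd
  obtain ⟨v, hv⟩ : ∃ v, ∀ w, w ≠ v → G.degree w ≤ 1 := by
    by_contra! hc
    obtain ⟨v, -, hv⟩ := hc (Classical.arbitrary V)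
    obtain ⟨w, hwv, hw⟩ := hc v
    refine htop (SimpleGraph.ext ?_)
    ext x y
    refine ⟨fun hxy => hxy.ne, fun hxy => ?_⟩
    have hxy : x ≠ y := hxy
    by_cases hxv : x = v
    · exact hxv ▸ huniv v hv y (hxv ▸ hxy)
    by_cases hxw : x = w
    · exact hxw ▸ huniv w hw y (hxw ▸ hxy)
    exact h x v w y hwv.symm (huniv v hv x (Ne.symm hxv)).symm
      (huniv w hw x (Ne.symm hxw)).symm hxy
  have hsum := G.sum_degrees_eq_twice_card_edges
  rw [← Finset.add_sum_erase _ _ (Finset.mem_univ v)] at hsum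
  have hle : ∑ w ∈ Finset.univ.erase v, G.degree w ≤ (Finset.univ.erase v).card • 1 :=
    Finset.sum_le_card_nsmul _ _ _ fun w hw => hv w (Finset.ne_of_mem_erase hw)
  rw [Finset.card_erase_of_mem (Finset.mem_univ v), Finset.card_univ, smul_eq_mul] at hle
  have hdeg := G.degree_lt_card_verts v
  omega

/-- The graph formed by the edges of colour `x`. -/
def colourGraph (n : ℕ) (c : Sym2 (Fin n) → Bool) (x : Bool) : SimpleGraph (Fin n) where
  Adj u v := u ≠ v ∧ c s(u, v) = x
  symm := ⟨fun u v h => ⟨h.1.symm, Sym2.eq_swap (a := u) (b := v) ▸ h.2⟩⟩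
  loopless := ⟨fun _ h => h.1 rfl⟩

instance (n : ℕ) (c : Sym2 (Fin n) → Bool) (x : Bool) : DecidableRel (colourGraph n c x).Adj :=
  fun _ _ => inferInstanceAs (Decidable (_ ∧ _))

theorem colourGraph_adj (n : ℕ) (c : Sym2 (Fin n) → Bool) (x : Bool) (u v : Fin n) :
    (colourGraph n c x).Adj u v ↔ u ≠ v ∧ c s(u, v) = x :=
  Iff.rfl

theorem colourGraph_edgeFinset (n : ℕ) (c : Sym2 (Fin n) → Bool) (x : Bool) :
    (colourGraph n c x).edgeFinset =
      (⊤ : SimpleGraph (Fin n)).edgeFinset.filter (fun e => c e = x) := by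
  ext e
  induction e with
  | h u v => simp [colourGraph_adj]

/-- If `n ≤ |E_x|` and some edge does not have colour `x`, then some vertex is the centre of a
star with two edges of colour `x` and one edge of the other colour. -/
theorem exists_star_of_le_card (n : ℕ) (hn : 5 ≤ n) (c : Sym2 (Fin n) → Bool) (x : Bool)
    (hx : n ≤ ((⊤ : SimpleGraph (Fin n)).edgeFinset.filter (fun e => c e = x)).card)
    (hy : 0 < ((⊤ : SimpleGraph (Fin n)).edgeFinset.filter (fun e => c e = !x)).card) :
    ∃ v a b d : Fin n, ([v, a, b, d] : List (Fin n)).Nodup ∧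
      c s(v, a) = x ∧ c s(v, b) = x ∧ c s(v, d) = !x := by
  by_contra hno
  have : NeZero n := ⟨by omega⟩
  have hadj : ∀ v a b d, a ≠ b → (colourGraph n c x).Adj v a → (colourGraph n c x).Adj v b →
      v ≠ d → (colourGraph n c x).Adj v d := by
    intro v a b d hab hva hvb hvd
    refine ⟨hvd, ?_⟩
    by_contra hd
    refine hno ⟨v, a, b, d, ?_, hva.2, hvb.2, Bool.eq_not.2 hd⟩
    have had : a ≠ d := fun h => hd (h ▸ hva.2)
    have hbd : b ≠ d := fun h => hd (h ▸ hvb.2)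
    simp [hva.1, hvb.1, hvd, hab, had, hbd]
  rcases (colourGraph n c x).eq_top_or_card_edgeFinset_lt hadj with htop | hlt
  · obtain ⟨e, he⟩ := Finset.card_pos.1 hy
    rw [Finset.mem_filter] at he
    have hmem : e ∈ (colourGraph n c x).edgeFinset := by
      rw [SimpleGraph.mem_edgeFinset, htop]
      exact SimpleGraph.mem_edgeFinset.1 he.1
    rw [colourGraph_edgeFinset, Finset.mem_filter, he.2] at hmem
    simp at hmem
  · rw [colourGraph_edgeFinset, Fintype.card_fin] at hlt
    omega

/-- Colouring exactly the edges at one vertex red gives `n - 1` red edges. -/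
theorem redEdges_card_star (n : ℕ) (z : Fin n) :
    (redEdges n (fun e => decide (z ∈ e))).card = n - 1 := by
  have h : redEdges n (fun e => decide (z ∈ e)) =
      (⊤ : SimpleGraph (Fin n)).incidenceFinset z := by
    ext e
    simp [redEdges, SimpleGraph.incidenceSet]
  rw [h, SimpleGraph.card_incidenceFinset_eq_degree, SimpleGraph.complete_graph_degree,
    Fintype.card_fin]

theorem redEdges_card_add_blueEdges_card (n : ℕ) (c : Sym2 (Fin n) → Bool) :
    (redEdges n c).card + (blueEdges n c).card = n.choose 2 := by
  have h := Finset.card_filter_add_card_filter_not (s := (⊤ : SimpleGraph (Fin n)).edgeFinset)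
    (fun e => c e = true)
  simp only [Bool.not_eq_true] at h
  rw [SimpleGraph.card_edgeFinset_top_eq_card_choose_two, Fintype.card_fin] at h
  exact h

/-- For every `n ≥ 5`, `sbal(n, K_{1,3}) = n - 1`: every 2-edge-colouring of `K_n` with
`min{|R|,|B|} ≥ n` contains both a copy of `K_{1,3}` with exactly two red edges and one
blue edge and a copy with exactly two blue edges and one red edge, while some
2-edge-colouring with `min{|R|,|B|} = n - 1` misses one of these two types of copy. -/
theorem sbal_K13 (n : ℕ) (hn : 5 ≤ n) :
    (∀ c : Sym2 (Fin n) → Bool,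
        n ≤ min (redEdges n c).card (blueEdges n c).card →
        StarCopy n c 2 1 ∧ StarCopy n c 1 2) ∧
    (∃ c : Sym2 (Fin n) → Bool,
        min (redEdges n c).card (blueEdges n c).card = n - 1 ∧
        (¬ StarCopy n c 2 1 ∨ ¬ StarCopy n c 1 2)) := by
  refine ⟨fun c hc => ?_, ?_⟩
  · obtain ⟨hr, hb⟩ := le_min_iff.1 hc
    constructor
    · obtain ⟨v, a, b, d, hnd, ha, hb, hd⟩ :=
        exists_star_of_le_card n hn c true hr (lt_of_lt_of_le (by omega) hb)
      exact ⟨v, a, b, d, hnd, by simp [ha, hb, hd], by simp [ha, hb, hd]⟩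
    · obtain ⟨v, a, b, d, hnd, ha, hb, hd⟩ :=
        exists_star_of_le_card n hn c false hb (lt_of_lt_of_le (by omega) hr)
      exact ⟨v, a, b, d, hnd, by simp [ha, hb, hd], by simp [ha, hb, hd]⟩
  · let z : Fin n := ⟨0, by omega⟩
    refine ⟨fun e => decide (z ∈ e), ?_, Or.inl ?_⟩
    · have hr := redEdges_card_star n z
      have ht := redEdges_card_add_blueEdges_card n (fun e => decide (z ∈ e))
      have hle : 2 * (n - 1) ≤ n.choose 2 := by
        rw [Nat.choose_two_right, Nat.le_div_iff_mul_le two_pos]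
        have := Nat.mul_le_mul_right (n - 1) (show 4 ≤ n by omega)
        omega
      omega
    · rintro ⟨v, a, b, d, hnd, h1, h2⟩
      by_cases hv : z = v
      · simp [hv] at h1
      · simp only [List.nodup_cons, List.mem_cons] at hnd
        simp only [Sym2.mem_iff, hv, false_or, decide_eq_true_eq] at h1
        grind
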